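/- Fix p21, r21, x22, x32, x33, y22, y32, y33 ∈ F, and for a, b ∈ F set M(a,b) := T₃(q)((0,0,0; p21,x22,0; a,x32,x33), (0,0,0; r21,y22,0; b,y32,y33)). Assume that for all a, b ∈ F the cyclic submodule M(a,b) is not free and is not contained in any free cyclic submodule of ²T₃(q) generated by a non-unimodular pair. Call the elements of 𝔸 := {M(a,b) : a, b ∈ F} points, call a free cyclic submodule ℓ of ²T₃(q) a line if ℓ contains some element of 𝔸, and say a point M lies on a line ℓ when M ⊆ ℓ. Then this incidence structure is an affine plane of order q; explicitly: (i) for any two distinct points there is exactly one line containing both of them; (ii) for every line ℓ and every point M with ¬(M ⊆ ℓ) there is exactly one line m such that M ⊆ m and no point is contained in both ℓ and m; (iii) there exist three points that are not all contained in one common line; (iv) every line contains exactly q points. -/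

import Mathlib

open Matrix

/-- `Mat n F` is the type of `n × n` matrices over `F`. -/
abbrev Mat (n : ℕ) (F : Type) : Type := Matrix (Fin n) (Fin n) F

/-- A matrix is lower triangular (i.e. belongs to the ring `T_n(q)`)
if all entries above the diagonal vanish. -/
def LowerTri {n : ℕ} {F : Type} [Zero F] (X : Mat n F) : Prop :=
  ∀ i j : Fin n, i < j → X i j = 0

/-- The cyclic left submodule `T_n(q)(X,Y)` of `²T_n(q)` generated by the pair `(X,Y)`. -/
def cyc {n : ℕ} {F : Type} [Field F] (X Y : Mat n F) : Set (Mat n F × Mat n F) :=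
  {p | ∃ A : Mat n F, LowerTri A ∧ p = (A * X, A * Y)}

/-- The pair `(X,Y)` generates a *free* cyclic submodule:
`A • (X,Y) = (0,0)` with `A ∈ T_n(q)` forces `A = 0`. -/
def IsFreePair {n : ℕ} {F : Type} [Field F] (X Y : Mat n F) : Prop :=
  ∀ A : Mat n F, LowerTri A → A * X = 0 → A * Y = 0 → A = 0

/-- A pair `(X,Y)` is unimodular if for every index `i` one of the `i`-th
diagonal entries of `X`, `Y` is nonzero. -/
def Unimodular {n : ℕ} {F : Type} [Field F] (X Y : Mat n F) : Prop :=
  ∀ i : Fin n, X i i ≠ 0 ∨ Y i i ≠ 0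

/-- `M` is a free cyclic submodule of `²T_n(q)`. -/
def IsFreeCyc {n : ℕ} {F : Type} [Field F] (M : Set (Mat n F × Mat n F)) : Prop :=
  ∃ X Y : Mat n F, LowerTri X ∧ LowerTri Y ∧ IsFreePair X Y ∧ M = cyc X Y

/-- `M` is a free cyclic submodule of `²T_n(q)` generated by a non-unimodular pair. -/
def IsNonUnimodFreeCyc {n : ℕ} {F : Type} [Field F] (M : Set (Mat n F × Mat n F)) : Prop :=
  ∃ X Y : Mat n F, LowerTri X ∧ LowerTri Y ∧ ¬ Unimodular X Y ∧ IsFreePair X Y ∧ M = cyc X Y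

/-- The point
`M(a,b) = T₃(q)((0,0,0; p21,x22,0; a,x32,x33),(0,0,0; r21,y22,0; b,y32,y33))`. -/
def Mpt3 {F : Type} [Field F] (p21 r21 x22 x32 x33 y22 y32 y33 a b : F) :
    Set (Mat 3 F × Mat 3 F) :=
  cyc !![0, 0, 0; p21, x22, 0; a, x32, x33] !![0, 0, 0; r21, y22, 0; b, y32, y33]

/-- A line: a free cyclic submodule of `²T₃(q)` containing some point `M(a,b)`. -/
def IsLine3 {F : Type} [Field F] (p21 r21 x22 x32 x33 y22 y32 y33 : F)
    (l : Set (Mat 3 F × Mat 3 F)) : Prop :=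
  IsFreeCyc l ∧ ∃ a b : F, Mpt3 p21 r21 x22 x32 x33 y22 y32 y33 a b ⊆ l

section Cyclic

variable {n : ℕ} {F : Type} [Field F]

theorem LowerTri.mul {A B : Mat n F} (hA : LowerTri A) (hB : LowerTri B) : LowerTri (A * B) := by
  intro i j hij
  rw [Matrix.mul_apply]
  refine Finset.sum_eq_zero fun k _ => ?_
  rcases lt_or_ge i k with h | h
  · rw [hA i k h, zero_mul]
  · rw [hB k j (h.trans_lt hij), mul_zero]

theorem lowerTri_one : LowerTri (1 : Mat n F) := fun _ _ h => Matrix.one_apply_ne h.ne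

theorem LowerTri.inv {A : Mat n F} (hA : LowerTri A) (hd : IsUnit A.det) : LowerTri A⁻¹ := by
  have := Matrix.invertibleOfIsUnitDet A hd
  have hb : A.BlockTriangular OrderDual.toDual := fun i j h => hA i j h
  intro i j hij
  exact Matrix.blockTriangular_inv_of_blockTriangular hb hij

theorem cyc_subset_iff {X Y X' Y' : Mat n F} :
    cyc X' Y' ⊆ cyc X Y ↔ ∃ A, LowerTri A ∧ X' = A * X ∧ Y' = A * Y := by
  constructor
  · intro h
    obtain ⟨A, hA, he⟩ := h ⟨1, lowerTri_one, rfl⟩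
    rw [one_mul, one_mul, Prod.mk.injEq] at he
    exact ⟨A, hA, he⟩
  · rintro ⟨A, hA, rfl, rfl⟩ _ ⟨B, hB, rfl⟩
    exact ⟨B * A, hB.mul hA, by rw [Matrix.mul_assoc, Matrix.mul_assoc]⟩

theorem cyc_mul_eq {A : Mat n F} (hA : LowerTri A) (hd : ∀ i, A i i ≠ 0) (X Y : Mat n F) :
    cyc (A * X) (A * Y) = cyc X Y := by
  have hu : IsUnit A.det := by
    rw [Matrix.det_of_isLowerTriangular A fun i j h => hA i j h, isUnit_iff_ne_zero]
    exact Finset.prod_ne_zero_iff.2 fun i _ => hd i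
  refine (cyc_subset_iff.2 ⟨A, hA, rfl, rfl⟩).antisymm
    (cyc_subset_iff.2 ⟨A⁻¹, hA.inv hu, ?_, ?_⟩) <;>
  rw [Matrix.nonsing_inv_mul_cancel_left _ _ hu]

theorem isFreePair_of_vecMul {X Y : Mat n F}
    (h : ∀ v : Fin n → F, v ᵥ* X = 0 → v ᵥ* Y = 0 → v = 0) : IsFreePair X Y := by
  intro A _ hX hY
  refine funext fun i => h (A i) ?_ ?_
  · rw [← Matrix.mul_apply_eq_vecMul, hX]; rfl
  · rw [← Matrix.mul_apply_eq_vecMul, hY]; rfl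

theorem IsFreePair.zero_zero_ne {X Y : Mat 3 F} (h : IsFreePair X Y) (hX : LowerTri X)
    (hY : LowerTri Y) : X 0 0 ≠ 0 ∨ Y 0 0 ≠ 0 := by
  by_contra! hc
  have key : ∀ Z : Mat 3 F, LowerTri Z → Z 0 0 = 0 →
      !![1, 0, 0; 0, 0, 0; 0, 0, 0] * Z = 0 := by
    intro Z hZ hz
    have h1 := hZ 0 1 (by decide)
    have h2 := hZ 0 2 (by decide)
    ext i j
    fin_cases i <;> fin_cases j <;> simp [Matrix.mul_apply, Fin.sum_univ_three, *]
  have := h _ (by intro i j hij; fin_cases i <;> fin_cases j <;> simp at hij ⊢)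
    (key X hX hc.1) (key Y hY hc.2)
  simpa using congrFun (congrFun this 0) 0

theorem lowerTri_three (a b c d e f : F) : LowerTri !![a, 0, 0; b, c, 0; d, e, f] := by
  intro i j hij
  fin_cases i <;> fin_cases j <;> simp at hij ⊢

theorem LowerTri.eq_three {A : Mat 3 F} (hA : LowerTri A) :
    A = !![A 0 0, 0, 0; A 1 0, A 1 1, 0; A 2 0, A 2 1, A 2 2] := by
  have h1 := hA 0 1 (by decide)
  have h2 := hA 0 2 (by decide)
  have h3 := hA 1 2 (by decide)
  ext i j
  fin_cases i <;> fin_cases j <;> simp [*]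

theorem three_mul_three (a b c d e f a' b' c' d' e' f' : F) :
    (!![a, 0, 0; b, c, 0; d, e, f] * !![a', 0, 0; b', c', 0; d', e', f'] : Mat 3 F) =
      !![a * a', 0, 0; b * a' + c * b', c * c', 0;
        d * a' + e * b' + f * d', e * c' + f * e', f * f'] := by
  ext i j
  fin_cases i <;> fin_cases j <;> simp [Matrix.mul_apply, Fin.sum_univ_three]

theorem three_inj {a b c d e f a' b' c' d' e' f' : F} :
    (!![a, 0, 0; b, c, 0; d, e, f] : Mat 3 F) = !![a', 0, 0; b', c', 0; d', e', f'] ↔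
      a = a' ∧ b = b' ∧ c = c' ∧ d = d' ∧ e = e' ∧ f = f' := by
  constructor
  · intro h
    have h' := fun i j => congrFun (congrFun h i) j
    exact ⟨h' 0 0, h' 1 0, h' 1 1, h' 2 0, h' 2 1, h' 2 2⟩
  · rintro ⟨rfl, rfl, rfl, rfl, rfl, rfl⟩
    rfl

/-- Freeness of a pair of lower triangular `3 × 3` matrices is linear independence of its rows. -/
theorem isFreePair_three {a b c d e f a' b' c' d' e' f' : F}
    (h : ∀ r s t : F, r * a + s * b + t * d = 0 → s * c + t * e = 0 → t * f = 0 →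
      r * a' + s * b' + t * d' = 0 → s * c' + t * e' = 0 → t * f' = 0 →
      r = 0 ∧ s = 0 ∧ t = 0) :
    IsFreePair !![a, 0, 0; b, c, 0; d, e, f] !![a', 0, 0; b', c', 0; d', e', f'] := by
  refine isFreePair_of_vecMul fun v hX hY => ?_
  have hX' := fun j => congrFun hX j
  have hY' := fun j => congrFun hY j
  simp only [Matrix.vecMul, dotProduct, Fin.sum_univ_three, Fin.forall_fin_succ] at hX' hY'
  simp at hX' hY'
  obtain ⟨h0, h1, h2⟩ := h (v 0) (v 1) (v 2) (by grind) (by grind) (by grind) (by grind)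
    (by grind) (by grind)
  ext i
  fin_cases i <;> assumption

end Cyclic

section Plane

variable {F : Type} [Field F] {p21 r21 x22 x32 x33 y22 y32 y33 : F}

/-- The line through the point `M(a,b)` in the direction `(h,k)`. -/
def lineCyc (p21 r21 x22 x32 x33 y22 y32 y33 h k a b : F) : Set (Mat 3 F × Mat 3 F) :=
  cyc !![h, 0, 0; p21, x22, 0; a, x32, x33] !![k, 0, 0; r21, y22, 0; b, y32, y33]

theorem middle_ne_zero
    (hN : ∀ a b : F, ∀ N : Set (Mat 3 F × Mat 3 F), IsNonUnimodFreeCyc N →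
      ¬ Mpt3 p21 r21 x22 x32 x33 y22 y32 y33 a b ⊆ N) : x22 ≠ 0 ∨ y22 ≠ 0 := by
  by_contra! hx
  obtain ⟨rfl, rfl⟩ := hx
  by_cases hu : x32 = 0 ∧ y32 = 0 ∧ x33 = 0 ∧ y33 = 0
  · obtain ⟨rfl, rfl, rfl, rfl⟩ := hu
    refine hN 0 0 (cyc !![1, 0, 0; 0, 0, 0; 0, 1, 0] !![0, 0, 0; 1, 0, 0; 0, 0, 0])
      ⟨_, _, lowerTri_three _ _ _ _ _ _, lowerTri_three _ _ _ _ _ _, ?_, ?_, rfl⟩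
      (cyc_subset_iff.2 ⟨!![0, 0, 0; p21, r21, 0; 0, 0, 0], lowerTri_three _ _ _ _ _ _, ?_, ?_⟩)
    · intro h
      simpa using h 1
    · refine isFreePair_three ?_
      grind
    all_goals rw [three_mul_three, three_inj]; simp
  · refine hN 0 0 (cyc !![1, 0, 0; 0, 0, 0; 0, x32, x33] !![0, 0, 0; 1, 0, 0; 0, y32, y33])
      ⟨_, _, lowerTri_three _ _ _ _ _ _, lowerTri_three _ _ _ _ _ _, ?_, ?_, rfl⟩
      (cyc_subset_iff.2 ⟨!![0, 0, 0; p21, r21, 0; 0, 0, 1], lowerTri_three _ _ _ _ _ _, ?_, ?_⟩)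
    · intro h
      simpa using h 1
    · refine isFreePair_three ?_
      grind
    all_goals rw [three_mul_three, three_inj]; simp

theorem last_ne_zero
    (hN : ∀ a b : F, ∀ N : Set (Mat 3 F × Mat 3 F), IsNonUnimodFreeCyc N →
      ¬ Mpt3 p21 r21 x22 x32 x33 y22 y32 y33 a b ⊆ N) : x33 ≠ 0 ∨ y33 ≠ 0 := by
  have hx := middle_ne_zero hN
  by_contra! hw
  obtain ⟨rfl, rfl⟩ := hw
  obtain ⟨a, b, hfree⟩ : ∃ a b : F,
      IsFreePair !![1, 0, 0; p21, x22, 0; a, x32, 0] !![0, 0, 0; r21, y22, 0; b, y32, 0] := by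
    by_cases hD : x22 * y32 = y22 * x32
    · obtain ⟨c, hc₁, hc₂⟩ : ∃ c, x32 = c * x22 ∧ y32 = c * y22 := by
        rcases hx with h | h
        · exact ⟨x32 / x22, by field_simp, by field_simp; grind⟩
        · exact ⟨y32 / y22, by field_simp; grind, by field_simp⟩
      refine ⟨c * p21, c * r21 + 1, isFreePair_three fun r s t h1 h2 _ h4 h5 _ => ?_⟩
      have hs : s + t * c = 0 := by
        rcases hx with h | h
        · exact (mul_eq_zero.1 (show (s + t * c) * x22 = 0 by grind)).resolve_right h
        · exact (mul_eq_zero.1 (show (s + t * c) * y22 = 0 by grind)).resolve_right h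
      grind
    · refine ⟨0, 0, isFreePair_three fun r s t h1 h2 _ h4 h5 _ => ?_⟩
      have ht : t = 0 :=
        (mul_eq_zero.1 (show t * (x22 * y32 - y22 * x32) = 0 by grind)).resolve_right
          (sub_ne_zero.2 hD)
      grind
  refine hN a b _ ⟨_, _, lowerTri_three _ _ _ _ _ _, lowerTri_three _ _ _ _ _ _, ?_, hfree, rfl⟩
    (cyc_subset_iff.2 ⟨!![0, 0, 0; 0, 1, 0; 0, 0, 1], lowerTri_three _ _ _ _ _ _, ?_, ?_⟩)
  · intro h
    simpa using h 2
  all_goals rw [three_mul_three, three_inj]; simp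

theorem mpt3_subset_lineCyc_iff_exists (hx : x22 ≠ 0 ∨ y22 ≠ 0) (hw : x33 ≠ 0 ∨ y33 ≠ 0)
    {h k a b a' b' : F} :
    Mpt3 p21 r21 x22 x32 x33 y22 y32 y33 a' b' ⊆ lineCyc p21 r21 x22 x32 x33 y22 y32 y33 h k a b ↔
      ∃ t, a' = a + t * h ∧ b' = b + t * k := by
  rw [Mpt3, lineCyc, cyc_subset_iff]
  constructor
  · rintro ⟨A, hA, h1, h2⟩
    rw [hA.eq_three, three_mul_three, three_inj] at h1 h2
    obtain ⟨-, -, -, h1, h1', h1''⟩ := h1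
    obtain ⟨-, -, -, h2, h2', h2''⟩ := h2
    have e3 : A 2 2 = 1 := by
      rcases hw with h | h
      · exact mul_right_cancel₀ h (by grind)
      · exact mul_right_cancel₀ h (by grind)
    have e2 : A 2 1 = 0 := by
      rcases hx with h | h
      · exact mul_right_cancel₀ h (by grind)
      · exact mul_right_cancel₀ h (by grind)
    exact ⟨A 2 0, by grind, by grind⟩
  · rintro ⟨t, rfl, rfl⟩
    refine ⟨!![0, 0, 0; 0, 1, 0; t, 0, 1], lowerTri_three _ _ _ _ _ _, ?_, ?_⟩ <;>
    · rw [three_mul_three, three_inj]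
      simp [add_comm]

theorem mpt3_subset_lineCyc_iff (hx : x22 ≠ 0 ∨ y22 ≠ 0) (hw : x33 ≠ 0 ∨ y33 ≠ 0) {h k : F}
    (hh : h ≠ 0 ∨ k ≠ 0) {a b a' b' : F} :
    Mpt3 p21 r21 x22 x32 x33 y22 y32 y33 a' b' ⊆ lineCyc p21 r21 x22 x32 x33 y22 y32 y33 h k a b ↔
      h * (b' - b) = k * (a' - a) := by
  rw [mpt3_subset_lineCyc_iff_exists hx hw]
  constructor
  · rintro ⟨t, rfl, rfl⟩
    ring
  · intro e
    rcases hh with hh | hh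
    · exact ⟨(a' - a) / h, by field_simp; ring, by field_simp; linear_combination e⟩
    · exact ⟨(b' - b) / k, by field_simp; linear_combination -e, by field_simp; ring⟩

theorem isLine3_lineCyc (hx : x22 ≠ 0 ∨ y22 ≠ 0) (hw : x33 ≠ 0 ∨ y33 ≠ 0) {h k : F}
    (hh : h ≠ 0 ∨ k ≠ 0) (a b : F) :
    IsLine3 p21 r21 x22 x32 x33 y22 y32 y33
      (lineCyc p21 r21 x22 x32 x33 y22 y32 y33 h k a b) := by
  refine ⟨⟨_, _, lowerTri_three _ _ _ _ _ _, lowerTri_three _ _ _ _ _ _, isFreePair_three ?_,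
    rfl⟩, a, b, (mpt3_subset_lineCyc_iff hx hw hh).2 (by ring)⟩
  intro r s t h1 h2 h3 h4 h5 h6
  obtain rfl : t = 0 := by
    rcases hw with h | h
    · exact (mul_eq_zero.1 h3).resolve_right h
    · exact (mul_eq_zero.1 h6).resolve_right h
  obtain rfl : s = 0 := by
    rcases hx with h | h
    · exact (mul_eq_zero.1 (by simpa using h2)).resolve_right h
    · exact (mul_eq_zero.1 (by simpa using h5)).resolve_right h
  refine ⟨?_, rfl, rfl⟩
  rcases hh with h | h
  · exact (mul_eq_zero.1 (by simpa using h1)).resolve_right h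
  · exact (mul_eq_zero.1 (by simpa using h4)).resolve_right h

theorem IsLine3.exists_eq_lineCyc (hx : x22 ≠ 0 ∨ y22 ≠ 0) (hw : x33 ≠ 0 ∨ y33 ≠ 0)
    {l : Set (Mat 3 F × Mat 3 F)} (hl : IsLine3 p21 r21 x22 x32 x33 y22 y32 y33 l) {a b : F}
    (hab : Mpt3 p21 r21 x22 x32 x33 y22 y32 y33 a b ⊆ l) :
    ∃ h k : F, (h ≠ 0 ∨ k ≠ 0) ∧ l = lineCyc p21 r21 x22 x32 x33 y22 y32 y33 h k a b := by
  obtain ⟨⟨X, Y, hX, hY, hf, rfl⟩, -⟩ := hl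
  refine ⟨X 0 0, Y 0 0, hf.zero_zero_ne hX hY, ?_⟩
  obtain ⟨A, hA, h1, h2⟩ := cyc_subset_iff.1 hab
  rw [hA.eq_three, hX.eq_three, three_mul_three, three_inj] at h1
  rw [hA.eq_three, hY.eq_three, three_mul_three, three_inj] at h2
  obtain ⟨-, e1, e2, e3, e4, e5⟩ := h1
  obtain ⟨-, f1, f2, f3, f4, f5⟩ := h2
  have hA1 : A 1 1 ≠ 0 := by
    intro h0
    simp [h0] at e2 f2
    tauto
  have hA2 : A 2 2 ≠ 0 := by
    intro h0
    simp [h0] at e5 f5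
    tauto
  rw [← cyc_mul_eq (lowerTri_three 1 (A 1 0) (A 1 1) (A 2 0) (A 2 1) (A 2 2))
    (by simp [Fin.forall_fin_succ, hA1, hA2]) X Y, lineCyc]
  congr 1
  · conv_lhs => rw [hX.eq_three]
    rw [three_mul_three, three_inj]
    exact ⟨one_mul _, e1.symm, e2.symm, e3.symm, e4.symm, e5.symm⟩
  · conv_lhs => rw [hY.eq_three]
    rw [three_mul_three, three_inj]
    exact ⟨one_mul _, f1.symm, f2.symm, f3.symm, f4.symm, f5.symm⟩

theorem lineCyc_eq_of_parallel {h k h' k' : F} (hh : h ≠ 0 ∨ k ≠ 0) (hh' : h' ≠ 0 ∨ k' ≠ 0)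
    (hp : h * k' = k * h') (a b : F) :
    lineCyc p21 r21 x22 x32 x33 y22 y32 y33 h k a b =
      lineCyc p21 r21 x22 x32 x33 y22 y32 y33 h' k' a b := by
  obtain ⟨s, hs, rfl, rfl⟩ : ∃ s : F, s ≠ 0 ∧ h = s * h' ∧ k = s * k' := by
    rcases hh' with h0 | h0
    · refine ⟨h / h', ?_, by field_simp, by field_simp; exact hp.symm⟩
      refine div_ne_zero ?_ h0
      grind
    · refine ⟨k / k', ?_, by field_simp; exact hp, by field_simp⟩
      refine div_ne_zero ?_ h0
      grind
  rw [lineCyc, lineCyc, ← cyc_mul_eq (lowerTri_three s 0 1 0 0 1)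
    (by simp [Fin.forall_fin_succ, hs]) !![h', 0, 0; _, _, 0; _, _, _] _, three_mul_three,
    three_mul_three]
  simp

theorem mpt3_injective (hx : x22 ≠ 0 ∨ y22 ≠ 0) (hw : x33 ≠ 0 ∨ y33 ≠ 0) {a b a' b' : F}
    (h : Mpt3 p21 r21 x22 x32 x33 y22 y32 y33 a b = Mpt3 p21 r21 x22 x32 x33 y22 y32 y33 a' b') :
    a = a' ∧ b = b' := by
  obtain ⟨t, ht⟩ := (mpt3_subset_lineCyc_iff_exists (h := 0) (k := 0) hx hw).1 h.subset
  simpa using ht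

end Plane

theorem stmt_17 (q : ℕ) (hq : 2 ≤ q)
    (F : Type) [Field F] [Fintype F] (hF : Fintype.card F = q)
    (p21 r21 x22 x32 x33 y22 y32 y33 : F)
    (hass : ∀ a b : F,
      ¬ IsFreeCyc (Mpt3 p21 r21 x22 x32 x33 y22 y32 y33 a b) ∧
      ∀ N : Set (Mat 3 F × Mat 3 F), IsNonUnimodFreeCyc N →
        ¬ Mpt3 p21 r21 x22 x32 x33 y22 y32 y33 a b ⊆ N) :
    -- (i) two distinct points lie on a unique line
    (∀ a b a' b' : F,
      Mpt3 p21 r21 x22 x32 x33 y22 y32 y33 a b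
        ≠ Mpt3 p21 r21 x22 x32 x33 y22 y32 y33 a' b' →
      ∃! l : Set (Mat 3 F × Mat 3 F), IsLine3 p21 r21 x22 x32 x33 y22 y32 y33 l ∧
        Mpt3 p21 r21 x22 x32 x33 y22 y32 y33 a b ⊆ l ∧
        Mpt3 p21 r21 x22 x32 x33 y22 y32 y33 a' b' ⊆ l) ∧
    -- (ii) the parallel axiom
    (∀ l : Set (Mat 3 F × Mat 3 F), IsLine3 p21 r21 x22 x32 x33 y22 y32 y33 l →
      ∀ a b : F, ¬ Mpt3 p21 r21 x22 x32 x33 y22 y32 y33 a b ⊆ l →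
        ∃! m : Set (Mat 3 F × Mat 3 F), IsLine3 p21 r21 x22 x32 x33 y22 y32 y33 m ∧
          Mpt3 p21 r21 x22 x32 x33 y22 y32 y33 a b ⊆ m ∧
          ∀ a' b' : F, ¬ (Mpt3 p21 r21 x22 x32 x33 y22 y32 y33 a' b' ⊆ l ∧
            Mpt3 p21 r21 x22 x32 x33 y22 y32 y33 a' b' ⊆ m)) ∧
    -- (iii) three non-collinear points exist
    (∃ a₁ b₁ a₂ b₂ a₃ b₃ : F, ¬ ∃ l : Set (Mat 3 F × Mat 3 F),
      IsLine3 p21 r21 x22 x32 x33 y22 y32 y33 l ∧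
      Mpt3 p21 r21 x22 x32 x33 y22 y32 y33 a₁ b₁ ⊆ l ∧
      Mpt3 p21 r21 x22 x32 x33 y22 y32 y33 a₂ b₂ ⊆ l ∧
      Mpt3 p21 r21 x22 x32 x33 y22 y32 y33 a₃ b₃ ⊆ l) ∧
    -- (iv) every line carries exactly q points
    (∀ l : Set (Mat 3 F × Mat 3 F), IsLine3 p21 r21 x22 x32 x33 y22 y32 y33 l →
      Set.ncard {P : Set (Mat 3 F × Mat 3 F) |
        (∃ a b : F, P = Mpt3 p21 r21 x22 x32 x33 y22 y32 y33 a b) ∧ P ⊆ l} = q) := by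
  have hx := middle_ne_zero fun a b => (hass a b).2
  have hw := last_ne_zero fun a b => (hass a b).2
  refine ⟨fun a b a' b' hne => ?_, fun l hl a b hab => ?_, ⟨0, 0, 1, 0, 0, 1, ?_⟩, fun l hl => ?_⟩
  · have hd : a' - a ≠ 0 ∨ b' - b ≠ 0 := by
      by_contra! hc
      exact hne (by rw [sub_eq_zero.1 hc.1, sub_eq_zero.1 hc.2])
    refine ⟨lineCyc p21 r21 x22 x32 x33 y22 y32 y33 (a' - a) (b' - b) a b,
      ⟨isLine3_lineCyc hx hw hd a b, (mpt3_subset_lineCyc_iff hx hw hd).2 (by ring),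
        (mpt3_subset_lineCyc_iff hx hw hd).2 (by ring)⟩, ?_⟩
    rintro m ⟨hm, hmab, hmab'⟩
    obtain ⟨h, k, hh, rfl⟩ := hm.exists_eq_lineCyc hx hw hmab
    exact lineCyc_eq_of_parallel hh hd ((mpt3_subset_lineCyc_iff hx hw hh).1 hmab') a b
  · obtain ⟨c, d, hcd⟩ := hl.2
    obtain ⟨h, k, hh, rfl⟩ := hl.exists_eq_lineCyc hx hw hcd
    rw [mpt3_subset_lineCyc_iff hx hw hh] at hab
    refine ⟨lineCyc p21 r21 x22 x32 x33 y22 y32 y33 h k a b,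
      ⟨isLine3_lineCyc hx hw hh a b, (mpt3_subset_lineCyc_iff hx hw hh).2 (by ring), ?_⟩, ?_⟩
    · rintro a' b' ⟨h1, h2⟩
      rw [mpt3_subset_lineCyc_iff hx hw hh] at h1 h2
      exact hab (by linear_combination h1 - h2)
    · rintro m ⟨hm, hmab, hdisj⟩
      obtain ⟨h', k', hh', rfl⟩ := hm.exists_eq_lineCyc hx hw hmab
      refine lineCyc_eq_of_parallel hh' hh ?_ a b
      by_contra hD
      have hD' : h * k' - k * h' ≠ 0 := fun h0 => hD (by linear_combination -h0)
      set t := (k * (a - c) - h * (b - d)) / (h * k' - k * h')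
      have htD : t * (h * k' - k * h') = k * (a - c) - h * (b - d) := div_mul_cancel₀ _ hD'
      refine hdisj (a + t * h') (b + t * k') ⟨(mpt3_subset_lineCyc_iff hx hw hh).2 ?_,
        (mpt3_subset_lineCyc_iff hx hw hh').2 (by ring)⟩
      linear_combination htD
  · rintro ⟨l, hl, h0, h1, h2⟩
    obtain ⟨h, k, hh, rfl⟩ := hl.exists_eq_lineCyc hx hw h0
    rw [mpt3_subset_lineCyc_iff hx hw hh] at h1 h2
    grind
  · obtain ⟨a, b, hab⟩ := hl.2
    obtain ⟨h, k, hh, rfl⟩ := hl.exists_eq_lineCyc hx hw hab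
    have hset : {P : Set (Mat 3 F × Mat 3 F) |
        (∃ a b : F, P = Mpt3 p21 r21 x22 x32 x33 y22 y32 y33 a b) ∧
          P ⊆ lineCyc p21 r21 x22 x32 x33 y22 y32 y33 h k a b} =
        Set.range fun t : F =>
          Mpt3 p21 r21 x22 x32 x33 y22 y32 y33 (a + t * h) (b + t * k) := by
      ext P
      constructor
      · rintro ⟨⟨a', b', rfl⟩, hP⟩
        obtain ⟨t, rfl, rfl⟩ := (mpt3_subset_lineCyc_iff_exists hx hw).1 hP
        exact ⟨t, rfl⟩
      · rintro ⟨t, rfl⟩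
        exact ⟨⟨_, _, rfl⟩, (mpt3_subset_lineCyc_iff_exists hx hw).2 ⟨t, rfl, rfl⟩⟩
    have hinj : Function.Injective fun t : F =>
        Mpt3 p21 r21 x22 x32 x33 y22 y32 y33 (a + t * h) (b + t * k) := by
      intro t t' e
      obtain ⟨e1, e2⟩ := mpt3_injective hx hw e
      rcases hh with hh | hh
      · exact mul_right_cancel₀ hh (add_left_cancel e1)
      · exact mul_right_cancel₀ hh (add_left_cancel e2)
    rw [hset, ← Set.image_univ, Set.ncard_image_of_injective _ hinj, Set.ncard_univ,
      Nat.card_eq_fintype_card, hF]
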